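/- Suppose β = 0 and p ∈ [0,1/2), and fix any initial configuration ξ₀ = S₀ ∈ 𝒟. Then for every ε > 0, Pr_{0,p}-almost surely, for all but finitely many t ∈ ℤ⁺, max_{0 ≤ s ≤ t} |ξ_s| ≤ t^{2/3}(log t)^{(1/3)+ε}. Moreover, there exists c(p) ∈ (0,∞) such that for every c ∈ (0,c(p)), Pr_{0,p}-almost surely, for all but finitely many t ∈ ℤ⁺, |ξ_t| ≥ c t^{1/2}. -/

import Mathlib

open MeasureTheory Filter
open scoped ENNReal NNReal

namespace EV

/-- A configuration of the exclusion-voter model is the finite hybrid-zone word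
(`false` = 0, `true` = 1); the full two-sided configuration is `1^∞ w 0^∞`. -/
abbrev Word := List Bool

/-- Canonical (normalized) words: empty (the ground state `𝒟₀`) or starting with
a `0` and ending with a `1`; these are in bijection with the configuration space `𝒟`. -/
def IsConfig (w : Word) : Prop :=
  w = [] ∨ (w.head? = some false ∧ w.getLast? = some true)

/-- The ground-state Heaviside configuration `𝒟₀ = …111000…`. -/
def groundState : Word := []

/-- Pad a word with one boundary symbol of the adjacent infinite block on each side. -/
def pad (w : Word) : Word := true :: (w ++ [false])

/-- Normalize: strip leading `1`s (they merge into the left infinite block of `1`s)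
and trailing `0`s (they merge into the right infinite block of `0`s). -/
def strip (w : Word) : Word :=
  ((w.dropWhile (· = true)).reverse.dropWhile (· = false)).reverse

def setPair (w : Word) (i : ℕ) (a b : Bool) : Word := (w.set i a).set (i + 1) b

def swapPair (w : Word) (i : ℕ) : Word :=
  setPair w i (w.getD (i + 1) true) (w.getD i true)

/-- Indices of the unlike adjacent pairs (`01` or `10`), read off the padded word. -/
def unlike (w : Word) : List ℕ :=
  (List.range (w.length + 1)).filter
    (fun i => (pad w).getD i true ≠ (pad w).getD (i + 1) true)

/-- One-step transition kernel of the discrete-time exclusion-voter chain with mixing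
parameter `β` and exclusion parameter `p`: an unlike adjacent pair is chosen uniformly
at random; with probability `β` a voter move flips the pair to `00` or `11` (each with
probability `1/2`); with probability `1-β` an exclusion move swaps a `01` with
probability `p` and a `10` with probability `1-p` (otherwise no change). -/
noncomputable def P (β p : ℝ) (w w' : Word) : ℝ :=
  ((unlike w).map (fun i =>
    let a := (pad w).getD i true
    let swapProb := if a then 1 - p else p
    ((unlike w).length : ℝ)⁻¹ *
      (β * (1 / 2) * (if strip (setPair (pad w) i false false) = w' then 1 else 0)
       + β * (1 / 2) * (if strip (setPair (pad w) i true true) = w' then 1 else 0)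
       + (1 - β) * swapProb * (if strip (swapPair (pad w) i) = w' then 1 else 0)
       + (1 - β) * (1 - swapProb) * (if w = w' then 1 else 0)))).sum

/-- `n`-step transition probabilities. -/
noncomputable def Pn (β p : ℝ) : ℕ → Word → Word → ℝ
  | 0 => fun w w' => if w = w' then 1 else 0
  | n + 1 => fun w w' => ∑' z : Word, Pn β p n w z * P β p z w'

/-- `w'` is accessible from `w`: some `n`-step transition probability is positive. -/
def Accessible (β p : ℝ) (w w' : Word) : Prop :=
  ∃ n : ℕ, 0 < n ∧ 0 < Pn β p n w w'

/-- Two states communicate: each is accessible from the other. -/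
def Communicate (β p : ℝ) (w w' : Word) : Prop :=
  Accessible β p w w' ∧ Accessible β p w' w

instance : MeasurableSpace Word := ⊤

/-- `ξ` is (a realization of) the discrete-time exclusion-voter Markov chain with
parameters `(β, p)` under the probability measure `μ`. -/
def IsEVChain (β p : ℝ) {Ω : Type*} [MeasurableSpace Ω] (μ : Measure Ω)
    (ξ : ℕ → Ω → Word) : Prop :=
  (∀ t, Measurable (ξ t)) ∧
  ∀ (t : ℕ) (path : ℕ → Word),
    μ {ω | ∀ i ≤ t + 1, ξ i ω = path i}
      = μ {ω | ∀ i ≤ t, ξ i ω = path i} * ENNReal.ofReal (P β p (path t) (path (t + 1)))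

/-- The relaxation time `τ = min {t ∈ ℕ, t ≥ 1 : ξ_t = 𝒟₀}` (`∞` if there is no such `t`). -/
noncomputable def relaxTime {Ω : Type*} (ξ : ℕ → Ω → Word) (ω : Ω) : ℝ≥0∞ :=
  sInf {r : ℝ≥0∞ | ∃ t : ℕ, 0 < t ∧ ξ t ω = groundState ∧ r = (t : ℝ≥0∞)}

/-- The size `|S|` of the hybrid zone. -/
def hz (w : Word) : ℕ := w.length

/-- The number of blocks `N(S)`: the number of (finite) `1`-blocks of the hybrid zone. -/
def nb (w : Word) : ℕ :=
  ((Finset.range w.length).filter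
    (fun b => w.getD b false = true ∧ (b = 0 ∨ w.getD (b - 1) true = false))).card

/-- Number of `0`s among the first `c` positions of the hybrid zone. -/
def z0 (w : Word) (c : ℕ) : ℕ :=
  ((Finset.range c).filter (fun a => w.getD a true = false)).card

/-- Number of `1`s of the hybrid zone at positions `≥ c`. -/
def o1 (w : Word) (c : ℕ) : ℕ :=
  ((Finset.Ico c w.length).filter (fun b => w.getD b false = true)).card

/-- `f₁(S) = Σᵢ mᵢ Rᵢ = Σᵢ nᵢ Tᵢ`: each `1` contributes the number of `0`s to its left. -/
def f1 (w : Word) : ℕ :=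
  ∑ b ∈ (Finset.range w.length).filter (fun b => w.getD b false = true), z0 w b

/-- `f₂(S) = (1/2)(Σᵢ mᵢ Rᵢ² + Σᵢ nᵢ Tᵢ²)`: each `1` contributes the squared number of
`0`s to its left, each `0` the squared number of `1`s to its right. -/
noncomputable def f2 (w : Word) : ℝ :=
  (1 / 2) *
    ((∑ b ∈ (Finset.range w.length).filter (fun b => w.getD b false = true),
        ((z0 w b : ℝ)) ^ 2)
     + (∑ a ∈ (Finset.range w.length).filter (fun a => w.getD a true = false),
        ((o1 w (a + 1) : ℝ)) ^ 2))

/-- `g(S) = max_{1 ≤ k ≤ N} R_k T_k`: the maximum over the `01`-corners of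
(number of `0`s up to the corner) × (number of `1`s after the corner). -/
def gfun (w : Word) : ℕ :=
  ((Finset.range w.length).filter
    (fun a => w.getD a true = false ∧ w.getD (a + 1) false = true)).sup
    (fun a => z0 w (a + 1) * o1 w (a + 1))

/-- `φ₁(S) = Σᵢ Σ_{j=R_{i-1}+1}^{R_i} Σ_{k=1}^{T_i} 1/(j+k)`: the `j`-th `0` (at position `a`,
so `j = z0 w (a+1)`) contributes `Σ_{k=1}^{T} 1/(j+k)` with `T` the number of `1`s to its right. -/
noncomputable def phi1 (w : Word) : ℝ :=
  ∑ a ∈ (Finset.range w.length).filter (fun a => w.getD a true = false),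
    ∑ k ∈ Finset.Icc 1 (o1 w (a + 1)), (1 : ℝ) / ((z0 w (a + 1) : ℝ) + (k : ℝ))


/-- `∑ r ^ (#0 before the cut + #1 after the cut)` over all cuts of the word. -/
noncomputable def cutSum (r : ℝ) : Word → ℝ
  | [] => 1
  | true :: u => r ^ (u.count true + 1) + cutSum r u
  | false :: u => r ^ (u.count true) + r * cutSum r u

/-- `(1 - r)` times the sum of `r ^ (#0 before the cut + #1 after the cut)` over all cuts of the
two-sided configuration `1^∞ u 0^∞`, including the two geometric tails. -/
noncomputable def cutWeight (r : ℝ) (u : Word) : ℝ :=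
  (1 - r) * cutSum r u + r * r ^ u.count true + r * r ^ u.count false

/-- The number of inversions: pairs of a `0` and a `1` to its right. -/
def inversions : Word → ℕ
  | [] => 0
  | true :: u => inversions u
  | false :: u => inversions u + u.count true

theorem cutSum_append_false (r : ℝ) (u : Word) :
    cutSum r (u ++ [false]) = cutSum r u + r * r ^ u.count false := by
  induction u with
  | nil => simp [cutSum]
  | cons b u ih => cases b <;> simp [cutSum, ih] <;> ring

theorem cutWeight_cons_true (r : ℝ) (u : Word) : cutWeight r (true :: u) = cutWeight r u := by
  simp [cutWeight, cutSum]; ring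

theorem cutWeight_append_false (r : ℝ) (u : Word) :
    cutWeight r (u ++ [false]) = cutWeight r u := by
  simp [cutWeight, cutSum_append_false]; ring

theorem inversions_append_false (u : Word) : inversions (u ++ [false]) = inversions u := by
  induction u with
  | nil => simp [inversions]
  | cons b u ih => cases b <;> simp [inversions, ih]

theorem cutSum_swap (r : ℝ) (x y : Word) :
    cutSum r (x ++ false :: true :: y)
      = cutSum r (x ++ true :: false :: y) - (1 - r ^ 2) * r ^ (x.count false + y.count true) := by
  induction x with
  | nil => simp [cutSum]; ring
  | cons b x ih => cases b <;> simp [cutSum, ih] <;> ring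

theorem cutWeight_swap (r : ℝ) (x y : Word) :
    cutWeight r (x ++ false :: true :: y)
      = cutWeight r (x ++ true :: false :: y)
        - (1 - r) * (1 - r ^ 2) * r ^ (x.count false + y.count true) := by
  simp [cutWeight, cutSum_swap]; ring

theorem inversions_swap (x y : Word) :
    inversions (x ++ false :: true :: y) = inversions (x ++ true :: false :: y) + 1 := by
  induction x with
  | nil => simp [inversions]; ring
  | cons b x ih => cases b <;> simp [inversions, ih]; ring

theorem count_mul_count_le_inversions (x y : Word) :
    x.count false * y.count true ≤ inversions (x ++ y) := by
  induction x with
  | nil => simp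
  | cons b x ih =>
    cases b
    · simp [inversions]; nlinarith
    · simpa [inversions] using ih

theorem inversions_le (u : Word) : inversions u ≤ u.length ^ 2 := by
  induction u with
  | nil => simp [inversions]
  | cons b u ih =>
    have h := List.count_le_length (a := true) (l := u)
    cases b <;> simp [inversions] <;> nlinarith

theorem cutSum_nonneg {r : ℝ} (hr : 0 ≤ r) (u : Word) : 0 ≤ cutSum r u := by
  induction u with
  | nil => simp [cutSum]
  | cons b u ih => cases b <;> simp only [cutSum] <;> positivity

theorem pow_count_le_cutSum {r : ℝ} (hr : 0 ≤ r) (x y : Word) :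
    r ^ (x.count false + y.count true) ≤ cutSum r (x ++ y) := by
  induction x with
  | nil =>
    have := cutSum_nonneg hr
    cases y with
    | nil => simp [cutSum]
    | cons b y => cases b <;> simp [cutSum] <;> nlinarith [this y]
  | cons b x ih =>
    have h0 := pow_nonneg hr (x.count true + y.count true)
    cases b
    · have := mul_le_mul_of_nonneg_left ih hr
      have e : r ^ (x.count false + 1 + y.count true) = r * r ^ (x.count false + y.count true) := by
        ring
      simp [cutSum, e]; linarith
    · have := mul_nonneg hr h0
      have e : r ^ (x.count true + y.count true + 1) = r * r ^ (x.count true + y.count true) := by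
        ring
      simp [cutSum, e]; linarith

theorem cutWeight_nonneg {r : ℝ} (hr : 0 ≤ r) (hr1 : r ≤ 1) (u : Word) : 0 ≤ cutWeight r u := by
  have := cutSum_nonneg hr u
  have := sub_nonneg.2 hr1
  unfold cutWeight
  positivity

theorem strip_cons_true (u : Word) : strip (true :: u) = strip u := by
  simp [strip]

theorem strip_append_false (u : Word) : strip (u ++ [false]) = strip u := by
  unfold strip
  congr 1
  induction u with
  | nil => simp
  | cons b u ih =>
    cases b
    · simp
    · simpa using ih

theorem length_strip_le (u : Word) : (strip u).length ≤ u.length := by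
  unfold strip
  rw [List.length_reverse]
  refine (List.dropWhile_sublist _).length_le.trans ?_
  rw [List.length_reverse]
  exact (List.dropWhile_sublist _).length_le

theorem apply_strip {α : Type*} (f : Word → α) (h1 : ∀ u, f (true :: u) = f u)
    (h2 : ∀ u, f (u ++ [false]) = f u) (u : Word) : f (strip u) = f u := by
  have hd : ∀ u : Word, f (u.dropWhile (· = true)) = f u := by
    intro u
    induction u with
    | nil => rfl
    | cons b u ih =>
      cases b
      · simp
      · simpa [h1] using ih
  have hr : ∀ u : Word, f ((u.reverse.dropWhile (· = false)).reverse) = f u := by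
    intro u
    induction u using List.reverseRecOn with
    | nil => rfl
    | append_singleton u b ih =>
      cases b
      · simpa [h2] using ih
      · simp
  rw [strip, hr, hd]

theorem cutWeight_strip (r : ℝ) (u : Word) : cutWeight r (strip u) = cutWeight r u :=
  apply_strip _ (cutWeight_cons_true r) (cutWeight_append_false r) u

theorem inversions_strip (u : Word) : inversions (strip u) = inversions u :=
  apply_strip _ (fun _ => rfl) inversions_append_false u

theorem cutWeight_pad (r : ℝ) (w : Word) : cutWeight r (pad w) = cutWeight r w := by
  rw [pad, cutWeight_cons_true, cutWeight_append_false]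

theorem inversions_pad (w : Word) : inversions (pad w) = inversions w :=
  inversions_append_false w

theorem length_pad (w : Word) : (pad w).length = w.length + 2 := by simp [pad]

theorem swapPair_append (x y : Word) (a b : Bool) :
    swapPair (x ++ a :: b :: y) x.length = x ++ b :: a :: y := by
  simp [swapPair, setPair]

theorem exists_eq_append_pair (u : Word) (i : ℕ) (hi : i + 1 < u.length) :
    ∃ x y : Word, x.length = i ∧ u = x ++ u.getD i true :: u.getD (i + 1) true :: y := by
  refine ⟨u.take i, u.drop (i + 2), by simp; omega, ?_⟩
  rw [List.getD_eq_getElem _ _ (by omega), List.getD_eq_getElem _ _ hi,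
    List.getElem_cons_drop, List.getElem_cons_drop, List.take_append_drop]

theorem length_strip_swap_le (x y w : Word) (a b : Bool) (h : pad w = x ++ a :: b :: y) :
    (strip (x ++ b :: a :: y)).length
      ≤ w.length + (if x = [] then 1 else 0) + (if y = [] then 1 else 0) := by
  have hx : x = [] ∨ ∃ x', x = true :: x' := by
    cases x with
    | nil => simp
    | cons c x =>
      simp only [pad, List.cons_append, List.cons.injEq] at h
      simp [← h.1]
  have hy : y = [] ∨ ∃ y', y = y' ++ [false] := by
    rcases List.eq_nil_or_concat y with rfl | ⟨y', c, rfl⟩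
    · simp
    · have h' := congrArg List.getLast? h
      simp [pad, List.getLast?_append, List.getLast?_cons] at h'
      simp [h']
  have hl := congrArg List.length h
  rw [length_pad] at hl
  rcases hx with rfl | ⟨x, rfl⟩ <;> rcases hy with rfl | ⟨y, rfl⟩
  · have := length_strip_le [b, a]
    simp at this hl ⊢
    omega
  · have h1 := strip_append_false (b :: a :: y)
    have := length_strip_le (b :: a :: y)
    simp at this hl h1 ⊢
    rw [h1]
    omega
  · have := length_strip_le (x ++ [b, a])
    simp [strip_cons_true] at this hl ⊢
    omega
  · have h1 := strip_append_false (x ++ b :: a :: y)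
    have := length_strip_le (x ++ b :: a :: y)
    simp [strip_cons_true] at this hl h1 ⊢
    rw [h1]
    omega

/-- Signed contribution of the adjacent pair `(i, i + 1)`: `+` for `10`, `-` for `01`, `0` for
like pairs, weighted by `r ^ (#0 before the middle cut + #1 after it)`. -/
noncomputable def cornerTerm (r : ℝ) (u : Word) (i : ℕ) : ℝ :=
  ((if u.getD i true then 1 else 0) - (if u.getD (i + 1) true then 1 else 0))
    * r ^ ((u.take (i + 1)).count false + (u.drop (i + 1)).count true)

theorem cornerTerm_cons_succ (r : ℝ) (b : Bool) (u : Word) (i : ℕ) :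
    cornerTerm r (b :: u) (i + 1) = (if b then 1 else r) * cornerTerm r u i := by
  cases b <;> simp [cornerTerm, pow_add]
  ring

theorem sum_cornerTerm_aux (r : ℝ) (w : Word) (b : Bool) :
    (1 + r) * ∑ i ∈ Finset.range (w.length + 1), cornerTerm r (b :: (w ++ [false])) i
      = (1 - r) * cutSum r (b :: (w ++ [false]))
        + (if b then r else -1) * r ^ (b :: w).count true + r * r ^ ((b :: w).count false + 1) := by
  induction w generalizing b with
  | nil => cases b <;> simp [cornerTerm, cutSum] <;> ring
  | cons c w ih =>
    have h := ih c
    rw [List.length_cons, Finset.sum_range_succ']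
    simp only [List.cons_append, cornerTerm_cons_succ, ← Finset.mul_sum]
    rw [mul_add, mul_left_comm, h]
    cases b <;> cases c <;> simp [cornerTerm, cutSum] <;> ring

theorem sum_cornerTerm (r : ℝ) (w : Word) :
    (1 + r) * ∑ i ∈ Finset.range (w.length + 1), cornerTerm r (pad w) i = cutWeight r w := by
  rw [pad, sum_cornerTerm_aux, ← cutWeight_pad, cutWeight, pad]
  simp

/-- The unlike adjacent pairs of the padded word, as a finset. -/
def unlikePairs (w : Word) : Finset ℕ :=
  (Finset.range (w.length + 1)).filter
    (fun i => (pad w).getD i true ≠ (pad w).getD (i + 1) true)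

theorem sum_unlikePairs_cornerTerm (r : ℝ) (w : Word) :
    (1 + r) * ∑ i ∈ unlikePairs w, cornerTerm r (pad w) i = cutWeight r w := by
  rw [← sum_cornerTerm, unlikePairs]
  congr 1
  refine Finset.sum_subset (Finset.filter_subset _ _) fun i hi hi' => ?_
  have : (pad w).getD i true = (pad w).getD (i + 1) true := by
    by_contra h
    exact hi' (Finset.mem_filter.2 ⟨hi, h⟩)
  rw [cornerTerm, this, sub_self, zero_mul]

theorem sum_unlikePairs_sign (w : Word) :
    ∑ i ∈ unlikePairs w, cornerTerm 1 (pad w) i = 1 := by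
  have := sum_unlikePairs_cornerTerm 1 w
  simp [cutWeight] at this
  linarith

theorem unlikePairs_card_pos (w : Word) : 0 < (unlikePairs w).card := by
  rw [Finset.card_pos, Finset.nonempty_iff_ne_empty]
  intro h
  have := sum_unlikePairs_sign w
  simp [h] at this

/-- Probability that a selected unlike pair `(i, i + 1)` is swapped. -/
noncomputable def swapRate (p : ℝ) (w : Word) (i : ℕ) : ℝ :=
  if (pad w).getD i true then 1 - p else p

/-- The mean of `V` after one pure-exclusion step from `w`. -/
noncomputable def stepMean (p : ℝ) (V : Word → ℝ) (w : Word) : ℝ :=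
  ((unlikePairs w).card : ℝ)⁻¹ * ∑ i ∈ unlikePairs w,
    (swapRate p w i * V (strip (swapPair (pad w) i)) + (1 - swapRate p w i) * V w)

/-- Case analysis on an unlike pair: it is a `10` which is swapped with probability `1 - p`,
or a `01` which is swapped with probability `p`. -/
theorem unlikePairs_cases {w : Word} {i : ℕ} (hi : i ∈ unlikePairs w) (p : ℝ) :
    ∃ x y : Word, x.length = i ∧
      ((pad w = x ++ true :: false :: y ∧ swapRate p w i = 1 - p ∧
        swapPair (pad w) i = x ++ false :: true :: y ∧
        ∀ r, cornerTerm r (pad w) i = r ^ (x.count false + y.count true)) ∨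
      (pad w = x ++ false :: true :: y ∧ swapRate p w i = p ∧
        swapPair (pad w) i = x ++ true :: false :: y ∧
        ∀ r, cornerTerm r (pad w) i = -(r ^ 2 * r ^ (x.count false + y.count true)))) := by
  obtain ⟨hi1, hi2⟩ := Finset.mem_filter.1 hi
  rw [Finset.mem_range] at hi1
  obtain ⟨x, y, rfl, hu⟩ := exists_eq_append_pair (pad w) i (by rw [length_pad]; omega)
  refine ⟨x, y, rfl, ?_⟩
  unfold swapRate cornerTerm
  generalize (pad w).getD x.length true = a at *
  generalize (pad w).getD (x.length + 1) true = b at *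
  have ht : ∀ a b, (x ++ a :: b :: y).take (x.length + 1) = x ++ [a] := by
    intro a b; simp [List.take_append]
  have hd : ∀ a b, (x ++ a :: b :: y).drop (x.length + 1) = b :: y := by
    intro a b; simp [List.drop_append]
  rw [hu, swapPair_append, ht, hd]
  cases a <;> cases b <;> simp at hi2 ⊢
  intro r
  ring

theorem stepMean_le_of_sum_le {p c : ℝ} {V : Word → ℝ} {w : Word}
    (h : ∑ i ∈ unlikePairs w, swapRate p w i * (V (strip (swapPair (pad w) i)) - V w)
      ≤ (unlikePairs w).card * ((c - 1) * V w)) :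
    stepMean p V w ≤ c * V w := by
  have hK : (0 : ℝ) < (unlikePairs w).card := Nat.cast_pos.2 (unlikePairs_card_pos w)
  rw [stepMean, inv_mul_le_iff₀ hK]
  have e : ∑ i ∈ unlikePairs w,
      (swapRate p w i * V (strip (swapPair (pad w) i)) + (1 - swapRate p w i) * V w)
      = ∑ i ∈ unlikePairs w, swapRate p w i * (V (strip (swapPair (pad w) i)) - V w)
        + (unlikePairs w).card * V w := by
    rw [← nsmul_eq_mul, ← Finset.sum_const, ← Finset.sum_add_distrib]
    exact Finset.sum_congr rfl fun i _ => by ring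
  rw [e]
  linarith

theorem stepMean_two_pow_inversions_le {p : ℝ} (hp0 : 0 ≤ p) (w : Word) :
    stepMean p (fun w => 2 ^ inversions w) w ≤ 2 * 2 ^ inversions w := by
  refine stepMean_le_of_sum_le (V := fun w => (2 : ℝ) ^ inversions w) ?_
  rw [← nsmul_eq_mul]
  refine Finset.sum_le_card_nsmul _ _ _ fun i hi => ?_
  have h0 : (0 : ℝ) < 2 ^ inversions w := by positivity
  obtain ⟨x, y, -, ⟨h1, h2, h3, -⟩ | ⟨h1, h2, h3, -⟩⟩ := unlikePairs_cases hi p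
  · have h4 : inversions (strip (swapPair (pad w) i)) = inversions w + 1 := by
      rw [inversions_strip, h3, inversions_swap, ← h1, inversions_pad]
    rw [h2, h4, pow_succ]
    nlinarith
  · have h4 : inversions w = inversions (strip (swapPair (pad w) i)) + 1 := by
      rw [inversions_strip, h3, ← inversions_swap, ← h1, inversions_pad]
    rw [h2]
    have : (2 : ℝ) ^ inversions (strip (swapPair (pad w) i)) ≤ 2 ^ inversions w :=
      pow_le_pow_right₀ (by norm_num) (by omega)
    nlinarith

theorem stepMean_pow_inversions_le {p s : ℝ} (hp0 : 0 ≤ p) (hs0 : 0 < s) (hs1 : s ≤ 1)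
    (hps : p ≤ s * (1 - p)) (w : Word) :
    stepMean p (fun w => s ^ inversions w) w
      ≤ (1 - (1 - s) * ((1 - p) - p / s) / 2) * s ^ inversions w := by
  refine stepMean_le_of_sum_le (V := fun w => s ^ inversions w) ?_
  have hV : 0 < s ^ inversions w := by positivity
  have key : ∀ i ∈ unlikePairs w,
      swapRate p w i * (s ^ inversions (strip (swapPair (pad w) i)) - s ^ inversions w)
        = -(1 - s) * s ^ inversions w *
          (((1 - p) + p / s) / 2 * cornerTerm 1 (pad w) i + ((1 - p) - p / s) / 2) := by
    intro i hi
    obtain ⟨x, y, -, ⟨h1, h2, h3, h5⟩ | ⟨h1, h2, h3, h5⟩⟩ := unlikePairs_cases hi p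
    · have h4 : inversions (strip (swapPair (pad w) i)) = inversions w + 1 := by
        rw [inversions_strip, h3, inversions_swap, ← h1, inversions_pad]
      rw [h2, h4, h5, pow_succ, one_pow]
      ring
    · have h4 : inversions w = inversions (strip (swapPair (pad w) i)) + 1 := by
        rw [inversions_strip, h3, ← inversions_swap, ← h1, inversions_pad]
      rw [h2, h4, h5, pow_succ, one_pow]
      field_simp
      ring
  rw [Finset.sum_congr rfl key, ← Finset.mul_sum, Finset.sum_add_distrib, ← Finset.mul_sum,
    sum_unlikePairs_sign, Finset.sum_const, nsmul_eq_mul]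
  have hps' : p / s ≤ 1 - p := by rw [div_le_iff₀ hs0]; linarith
  have hq : 0 ≤ (1 - s) * s ^ inversions w * ((1 - p) + p / s) := by
    have h1 : 0 ≤ 1 - s := by linarith
    have h2 : 0 ≤ 1 - p + p / s := by
      have := div_nonneg hp0 hs0.le
      linarith
    positivity
  nlinarith

theorem sum_unlikePairs_ends_le (w : Word) :
    ∑ i ∈ unlikePairs w, ((if i = 0 then 1 else 0) + (if i = w.length then 1 else 0) : ℝ) ≤ 2 := by
  rw [Finset.sum_add_distrib, Finset.sum_ite_eq', Finset.sum_ite_eq']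
  split_ifs <;> norm_num

/-- If `B` is close enough to `1`, then `B ^ |w| * cutWeight r w` is a supermartingale: the
exponential contraction of `cutWeight` beats the growth of the hybrid zone. -/
theorem stepMean_lengthWeight_le {p r B : ℝ} (hp0 : 0 ≤ p) (hp1 : p ≤ 1) (hr0 : 0 < r)
    (hr1 : r ≤ 1) (hpr : p ≤ r ^ 2 * (1 - p)) (hB1 : 1 ≤ B) (hB : B ^ 2 ≤ 1 + (1 - r) ^ 2)
    (w : Word) :
    stepMean p (fun w => B ^ w.length * cutWeight r w) w
      ≤ 1 * (B ^ w.length * cutWeight r w) := by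
  refine stepMean_le_of_sum_le (V := fun w => B ^ w.length * cutWeight r w) ?_
  have hG : 0 ≤ cutWeight r w := cutWeight_nonneg hr0.le hr1 w
  have hBL : 0 < B ^ w.length := by positivity
  have key : ∀ i ∈ unlikePairs w,
      swapRate p w i * (B ^ (strip (swapPair (pad w) i)).length
          * cutWeight r (strip (swapPair (pad w) i)) - B ^ w.length * cutWeight r w)
        ≤ B ^ w.length * (-(1 - p) * (1 - r) * (1 - r ^ 2) * cornerTerm r (pad w) i
          + (1 - p) * ((B ^ 2 - 1) / 2) * cutWeight r w
            * ((if i = 0 then 1 else 0) + (if i = w.length then 1 else 0))) := by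
    intro i hi
    obtain ⟨x, y, hx, hxy⟩ := unlikePairs_cases hi p
    have hr2 : 0 ≤ 1 - r ^ 2 := by nlinarith
    have hr1' : 0 ≤ 1 - r := by linarith
    have hp' : 0 ≤ 1 - p := by linarith
    have hBe : 0 ≤ B ^ 2 - 1 := by nlinarith
    set D : ℝ := (1 - r) * (1 - r ^ 2) * r ^ (x.count false + y.count true) with hD
    have hD0 : 0 ≤ D := by positivity
    set G' := cutWeight r (strip (swapPair (pad w) i)) with hG'
    have hG'0 : 0 ≤ G' := cutWeight_nonneg hr0.le hr1 _
    rcases hxy with ⟨h1, h2, h3, h5⟩ | ⟨h1, h2, h3, h5⟩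
    · have h4 : G' = cutWeight r w - D := by
        rw [hG', cutWeight_strip, h3, cutWeight_swap, ← h1, cutWeight_pad]
      have hl := congrArg List.length h1
      rw [length_pad] at hl
      simp only [List.length_append, List.length_cons] at hl
      have hx0 : x = [] ↔ i = 0 := by rw [← List.length_eq_zero_iff, hx]
      have hy0 : y = [] ↔ i = w.length := by rw [← List.length_eq_zero_iff]; omega
      have hlen := length_strip_swap_le x y w true false h1
      rw [← h3] at hlen
      simp only [hx0, hy0] at hlen
      have hpow : B ^ (strip (swapPair (pad w) i)).length ≤ B ^ w.length *
          (1 + (B ^ 2 - 1) / 2 * ((if i = 0 then 1 else 0) + (if i = w.length then 1 else 0))) := by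
        refine (pow_le_pow_right₀ hB1 hlen).trans ?_
        rw [add_assoc, pow_add]
        refine mul_le_mul_of_nonneg_left ?_ hBL.le
        split_ifs <;> norm_num <;> nlinarith
      set e : ℝ := (if i = 0 then 1 else 0) + (if i = w.length then 1 else 0) with he
      have he0 : 0 ≤ e := by rw [he]; split_ifs <;> norm_num
      rw [h2, h5]
      have h6 := mul_le_mul_of_nonneg_right hpow hG'0
      have h7 : G' ≤ cutWeight r w := by linarith
      have h8 := mul_le_mul_of_nonneg_left h7
        (show 0 ≤ B ^ w.length * ((B ^ 2 - 1) / 2 * e) by positivity)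
      calc _ ≤ (1 - p) * (B ^ w.length * (-D + (B ^ 2 - 1) / 2 * e * cutWeight r w)) := by
            refine mul_le_mul_of_nonneg_left ?_ hp'
            have h9 : B ^ w.length * G' = B ^ w.length * cutWeight r w - B ^ w.length * D := by
              rw [h4]; ring
            linarith
        _ = _ := by rw [hD]; ring
    · have h4 : G' = cutWeight r w + D := by
        have := cutWeight_swap r x y
        rw [← h1, cutWeight_pad, ← h3, ← hD] at this
        rw [hG', cutWeight_strip]
        linarith
      have hlen := length_strip_swap_le x y w false true h1
      have hx0 : x ≠ [] := by
        rintro rfl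
        simp [pad] at h1
      have hy0 : y ≠ [] := by
        rintro rfl
        have h' := congrArg List.getLast? h1
        simp [pad, List.getLast?_append, List.getLast?_cons] at h'
      rw [← h3, if_neg hx0, if_neg hy0, add_zero, add_zero] at hlen
      have hpow := mul_le_mul_of_nonneg_right (pow_le_pow_right₀ hB1 hlen) hG'0
      set e : ℝ := (if i = 0 then 1 else 0) + (if i = w.length then 1 else 0) with he
      have he0 : 0 ≤ e := by rw [he]; split_ifs <;> norm_num
      rw [h2, h5]
      have h6 := mul_le_mul_of_nonneg_right hpr (mul_nonneg hBL.le hD0)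
      have h7 : 0 ≤ B ^ w.length * ((1 - p) * ((B ^ 2 - 1) / 2) * cutWeight r w * e) := by
        positivity
      calc _ ≤ p * (B ^ w.length * D) := by
            refine mul_le_mul_of_nonneg_left ?_ hp0
            have h9 : B ^ w.length * G' = B ^ w.length * cutWeight r w + B ^ w.length * D := by
              rw [h4]; ring
            linarith
        _ ≤ r ^ 2 * (1 - p) * (B ^ w.length * D)
            + B ^ w.length * ((1 - p) * ((B ^ 2 - 1) / 2) * cutWeight r w * e) := by linarith
        _ = _ := by rw [hD]; ring
  refine (Finset.sum_le_sum key).trans ?_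
  rw [← Finset.mul_sum, Finset.sum_add_distrib, ← Finset.mul_sum, ← Finset.mul_sum]
  have h1 := sum_unlikePairs_cornerTerm r w
  have h2 := sum_unlikePairs_ends_le w
  have h3 : -(1 - p) * (1 - r) * (1 - r ^ 2) * ∑ i ∈ unlikePairs w, cornerTerm r (pad w) i
      = -(1 - p) * (1 - r) ^ 2 * cutWeight r w := by
    rw [← h1]; ring
  rw [h3]
  have hp' : 0 ≤ 1 - p := by linarith
  have h4 := mul_le_mul_of_nonneg_left h2
    (show 0 ≤ (1 - p) * ((B ^ 2 - 1) / 2) * cutWeight r w by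
      have : 0 ≤ B ^ 2 - 1 := by nlinarith
      positivity)
  have h5 := mul_le_mul_of_nonneg_left hB (mul_nonneg hp' hG)
  rw [sub_self, zero_mul, mul_zero]
  refine mul_nonpos_of_nonneg_of_nonpos hBL.le ?_
  nlinarith

theorem P_zero_eq_sum (p : ℝ) (w w' : Word) :
    P 0 p w w' = ∑ i ∈ unlikePairs w, ((unlikePairs w).card : ℝ)⁻¹ *
      (swapRate p w i * (if strip (swapPair (pad w) i) = w' then 1 else 0)
        + (1 - swapRate p w i) * (if w = w' then 1 else 0)) := by
  have hnd : (unlike w).Nodup := List.nodup_range.filter _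
  have hU : (unlike w).toFinset = unlikePairs w := by
    ext i
    simp [unlike, unlikePairs]
  have hc : (unlike w).length = (unlikePairs w).card := by
    rw [← hU, List.toFinset_card_of_nodup hnd]
  rw [P, ← List.sum_toFinset _ hnd, hU, hc]
  refine Finset.sum_congr rfl fun i _ => ?_
  simp only [swapRate]
  ring

theorem swapRate_mem {p : ℝ} (hp0 : 0 ≤ p) (hp1 : p ≤ 1) (w : Word) (i : ℕ) :
    0 ≤ swapRate p w i ∧ 0 ≤ 1 - swapRate p w i := by
  unfold swapRate
  split_ifs <;> constructor <;> linarith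

theorem P_zero_nonneg {p : ℝ} (hp0 : 0 ≤ p) (hp1 : p ≤ 1) (w w' : Word) : 0 ≤ P 0 p w w' := by
  rw [P_zero_eq_sum]
  refine Finset.sum_nonneg fun i _ => ?_
  obtain ⟨h1, h2⟩ := swapRate_mem hp0 hp1 w i
  positivity

theorem tsum_P_mul_eq_stepMean {p : ℝ} (hp0 : 0 ≤ p) (hp1 : p ≤ 1) {V : Word → ℝ}
    (hV : ∀ w, 0 ≤ V w) (w : Word) :
    ∑' w', ENNReal.ofReal (P 0 p w w') * ENNReal.ofReal (V w')
      = ENNReal.ofReal (stepMean p V w) := by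
  set T : Finset Word := insert w ((unlikePairs w).image fun i => strip (swapPair (pad w) i))
  have hT : ∀ i ∈ unlikePairs w, strip (swapPair (pad w) i) ∈ T := fun i hi =>
    Finset.mem_insert_of_mem (Finset.mem_image_of_mem _ hi)
  have hw : w ∈ T := Finset.mem_insert_self _ _
  rw [tsum_eq_sum (s := T)]
  · simp_rw [← ENNReal.ofReal_mul (P_zero_nonneg hp0 hp1 w _)]
    rw [← ENNReal.ofReal_sum_of_nonneg fun w' _ =>
      mul_nonneg (P_zero_nonneg hp0 hp1 w w') (hV w')]
    congr 1
    simp_rw [P_zero_eq_sum, Finset.sum_mul]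
    rw [Finset.sum_comm, stepMean, Finset.mul_sum]
    refine Finset.sum_congr rfl fun i hi => ?_
    simp_rw [mul_assoc, ← Finset.mul_sum, add_mul, Finset.sum_add_distrib, mul_assoc,
      ← Finset.mul_sum, ite_mul, one_mul, zero_mul]
    rw [Finset.sum_ite_eq, Finset.sum_ite_eq, if_pos (hT i hi), if_pos hw]
  · intro w' hw'
    have : P 0 p w w' = 0 := by
      rw [P_zero_eq_sum]
      refine Finset.sum_eq_zero fun i hi => ?_
      rw [if_neg, if_neg]
      · simp
      · rintro rfl
        exact hw' hw
      · rintro rfl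
        exact hw' (hT i hi)
    simp [this]

instance : DiscreteMeasurableSpace Word := ⟨fun _ => trivial⟩

section Chain

variable {Ω : Type*} [MeasurableSpace Ω] {μ : Measure Ω} {ξ : ℕ → Ω → Word} {p : ℝ}

theorem lintegral_succ_le {β : ℝ} (hξ : IsEVChain β p μ ξ) {V : Word → ℝ≥0∞} {c : ℝ≥0∞}
    (hV : ∀ w, ∑' w', ENNReal.ofReal (P β p w w') * V w' ≤ c * V w) (t : ℕ) :
    ∫⁻ ω, V (ξ (t + 1) ω) ∂μ ≤ c * ∫⁻ ω, V (ξ t ω) ∂μ := by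
  obtain ⟨hm, hP⟩ := hξ
  have hH : Measurable fun ω => fun i : Fin (t + 1) => ξ i ω := measurable_pi_lambda _ fun i => hm i
  set H : Ω → Fin (t + 1) → Word := fun ω i => ξ i ω with hHdef
  have h1 : ∫⁻ ω, V (ξ t ω) ∂μ = ∑' h : Fin (t + 1) → Word, V (h (Fin.last t)) * μ (H ⁻¹' {h}) := by
    have := lintegral_map (μ := μ) (f := fun h : Fin (t + 1) → Word => V (h (Fin.last t)))
      (Measurable.of_discrete.comp (measurable_pi_apply _)) hH
    rw [show ∫⁻ ω, V (ξ t ω) ∂μ = ∫⁻ ω, V (H ω (Fin.last t)) ∂μ by simp [H], ← this,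
      lintegral_countable']
    refine tsum_congr fun h => ?_
    rw [Measure.map_apply hH (measurableSet_singleton h)]
  have hHξ : Measurable fun ω => (H ω, ξ (t + 1) ω) := hH.prodMk (hm (t + 1))
  have h2 : ∫⁻ ω, V (ξ (t + 1) ω) ∂μ = ∑' (h : Fin (t + 1) → Word) (w' : Word),
      V w' * (μ (H ⁻¹' {h}) * ENNReal.ofReal (P β p (h (Fin.last t)) w')) := by
    have := lintegral_map (μ := μ) (f := fun q : (Fin (t + 1) → Word) × Word => V q.2)
      (Measurable.of_discrete.comp measurable_snd) hHξ
    rw [show ∫⁻ ω, V (ξ (t + 1) ω) ∂μ = ∫⁻ ω, V (H ω, ξ (t + 1) ω).2 ∂μ from rfl, ← this,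
      lintegral_countable', ENNReal.tsum_prod']
    refine tsum_congr fun h => tsum_congr fun w' => ?_
    rw [Measure.map_apply hHξ (measurableSet_singleton _)]
    congr 1
    have h3 := hP t fun i => if hi : i < t + 1 then h ⟨i, hi⟩ else w'
    have e1 : {ω | ∀ i ≤ t, ξ i ω = if hi : i < t + 1 then h ⟨i, hi⟩ else w'} = H ⁻¹' {h} := by
      ext ω
      simp only [Set.mem_ofPred_eq, Set.mem_preimage, Set.mem_singleton_iff, funext_iff, H]
      refine ⟨fun hω i => ?_, fun hω i hi => ?_⟩
      · have := hω i (by omega)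
        rwa [dif_pos i.2] at this
      · rw [dif_pos (by omega)]
        exact hω ⟨i, by omega⟩
    have e2 : {ω | ∀ i ≤ t + 1, ξ i ω = if hi : i < t + 1 then h ⟨i, hi⟩ else w'}
        = (fun ω => (H ω, ξ (t + 1) ω)) ⁻¹' {(h, w')} := by
      ext ω
      simp only [Set.mem_ofPred_eq, Set.mem_preimage, Set.mem_singleton_iff, Prod.mk.injEq,
        funext_iff, H]
      refine ⟨fun hω => ⟨fun i => ?_, ?_⟩, fun hω i hi => ?_⟩
      · have := hω i (by omega)
        rwa [dif_pos i.2] at this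
      · simpa using hω (t + 1) le_rfl
      · by_cases hi' : i < t + 1
        · rw [dif_pos hi']
          exact hω.1 ⟨i, hi'⟩
        · rw [dif_neg hi', show i = t + 1 by omega]
          exact hω.2
    rw [e1, e2] at h3
    rw [h3]
    simp [Fin.last]
  rw [h1, h2, ← ENNReal.tsum_mul_left]
  refine ENNReal.tsum_le_tsum fun h => ?_
  calc ∑' w', V w' * (μ (H ⁻¹' {h}) * ENNReal.ofReal (P β p (h (Fin.last t)) w'))
      = μ (H ⁻¹' {h}) * ∑' w', ENNReal.ofReal (P β p (h (Fin.last t)) w') * V w' := by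
        rw [← ENNReal.tsum_mul_left]
        exact tsum_congr fun w' => by ring
    _ ≤ μ (H ⁻¹' {h}) * (c * V (h (Fin.last t))) := by gcongr; exact hV _
    _ = c * (V (h (Fin.last t)) * μ (H ⁻¹' {h})) := by ring

/-- First-moment Borel–Cantelli bound from a one-step multiplicative drift condition. -/
theorem ae_eventually_lt_of_stepMean_le [IsProbabilityMeasure μ] (hp0 : 0 ≤ p) (hp1 : p ≤ 1)
    (hξ : IsEVChain 0 p μ ξ) {S₀ : Word} (h0 : ∀ᵐ ω ∂μ, ξ 0 ω = S₀)
    {V : Word → ℝ} (hV : ∀ w, 0 ≤ V w) {c : ℝ} (hc : 0 ≤ c)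
    (hstep : ∀ w, stepMean p V w ≤ c * V w)
    {b : ℕ → ℝ} (hb : ∀ t, 0 < b t) (hsum : Summable fun t => c ^ t / b t) :
    ∀ᵐ ω ∂μ, ∀ᶠ t in atTop, V (ξ t ω) < b t := by
  have hE : ∀ t, ∫⁻ ω, ENNReal.ofReal (V (ξ t ω)) ∂μ ≤ ENNReal.ofReal (c ^ t * V S₀) := by
    intro t
    induction t with
    | zero =>
      have : ∫⁻ ω, ENNReal.ofReal (V (ξ 0 ω)) ∂μ = ∫⁻ _, ENNReal.ofReal (V S₀) ∂μ :=
        lintegral_congr_ae (h0.mono fun ω h => by simp only [h])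
      simp [this]
    | succ t ih =>
      refine (lintegral_succ_le hξ (V := fun w => ENNReal.ofReal (V w))
        (c := ENNReal.ofReal c) (fun w => ?_) t).trans ?_
      · rw [tsum_P_mul_eq_stepMean hp0 hp1 hV, ← ENNReal.ofReal_mul hc]
        exact ENNReal.ofReal_le_ofReal (hstep w)
      · refine (mul_le_mul_right ih _).trans ?_
        rw [← ENNReal.ofReal_mul hc, pow_succ]
        exact ENNReal.ofReal_le_ofReal (by linarith)
  have hmeas : ∀ t, Measurable fun ω => ENNReal.ofReal (V (ξ t ω) / b t) := fun t =>
    Measurable.comp (g := fun w => ENNReal.ofReal (V w / b t)) Measurable.of_discrete (hξ.1 t)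
  have hfin : ∫⁻ ω, ∑' t, ENNReal.ofReal (V (ξ t ω) / b t) ∂μ ≠ ∞ := by
    rw [lintegral_tsum fun t => (hmeas t).aemeasurable]
    have hs : Summable fun t => c ^ t / b t * V S₀ := hsum.mul_right _
    refine ne_top_of_le_ne_top hs.tsum_ofReal_ne_top (ENNReal.tsum_le_tsum fun t => ?_)
    have e : ∀ x : ℝ, ENNReal.ofReal (x / b t) = ENNReal.ofReal (b t)⁻¹ * ENNReal.ofReal x := by
      intro x
      rw [← ENNReal.ofReal_mul (inv_nonneg.2 (hb t).le), div_eq_inv_mul]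
    simp_rw [e]
    rw [lintegral_const_mul' _ _ ENNReal.ofReal_ne_top]
    refine (mul_le_mul_right (hE t) _).trans (le_of_eq ?_)
    rw [← ENNReal.ofReal_mul (inv_nonneg.2 (hb t).le)]
    congr 1
    ring
  filter_upwards [ae_lt_top (Measurable.tsum hmeas) hfin] with ω hω
  have := (ENNReal.tendsto_atTop_zero_of_tsum_ne_top hω.ne).eventually_lt_const zero_lt_one
  filter_upwards [this] with t ht
  rw [ENNReal.ofReal_lt_one, div_lt_one (hb t)] at ht
  exact ht

end Chain

/-- The square of the cut at which as many `0`s lie to the left as `1`s to the right is at most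
the number of inversions, and this cut alone already bounds `cutWeight` from below. -/
theorem exists_sq_le_inversions_le_cutWeight {r : ℝ} (hr0 : 0 ≤ r) (hr1 : r ≤ 1) (w : Word) :
    ∃ d : ℕ, d ^ 2 ≤ inversions w ∧ (1 - r) * r ^ (2 * d) ≤ cutWeight r w := by
  set x := w.take (w.count true) with hx
  set y := w.drop (w.count true) with hy
  have hw : x ++ y = w := List.take_append_drop _ _
  have hlen : x.length = w.count true := by
    rw [hx, List.length_take, min_eq_left List.count_le_length]
  have h1 : x.count true + x.count false = x.length := List.count_true_add_count_false x
  have h2 : w.count true = x.count true + y.count true := by rw [← hw, List.count_append]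
  have hd : y.count true = x.count false := by omega
  refine ⟨x.count false, ?_, ?_⟩
  · have := count_mul_count_le_inversions x y
    rwa [hw, hd, ← sq] at this
  · have h3 := pow_count_le_cutSum hr0 x y
    rw [hw, hd, ← two_mul] at h3
    have h4 := mul_le_mul_of_nonneg_left h3 (sub_nonneg.2 hr1)
    have h5 : 0 ≤ r * r ^ w.count true := by positivity
    have h6 : 0 ≤ r * r ^ w.count false := by positivity
    rw [cutWeight]
    linarith

section Bounds

variable {Ω : Type*} [MeasurableSpace Ω] {μ : Measure Ω} [IsProbabilityMeasure μ]
  {ξ : ℕ → Ω → Word} {p : ℝ} {S₀ : Word}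

theorem ae_eventually_inversions_le (hp0 : 0 ≤ p) (hp1 : p ≤ 1) (hξ : IsEVChain 0 p μ ξ)
    (h0 : ∀ᵐ ω ∂μ, ξ 0 ω = S₀) :
    ∀ᵐ ω ∂μ, ∀ᶠ t in atTop, inversions (ξ t ω) ≤ 2 * t := by
  have := ae_eventually_lt_of_stepMean_le hp0 hp1 hξ h0 (V := fun w => 2 ^ inversions w)
    (fun w => by positivity) (c := 2) (by norm_num) (stepMean_two_pow_inversions_le hp0)
    (b := fun t => 4 ^ t) (fun t => by positivity) (by
      simp_rw [← div_pow]
      exact summable_geometric_of_lt_one (by norm_num) (by norm_num))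
  filter_upwards [this] with ω hω
  filter_upwards [hω] with t ht
  rw [show (4 : ℝ) = 2 ^ 2 by norm_num, ← pow_mul] at ht
  exact ((pow_lt_pow_iff_right₀ (by norm_num)).1 ht).le

theorem exists_linear_lower_bound_inversions (hp0 : 0 ≤ p) (hp : p < 1 / 2) :
    ∃ a : ℝ, 0 < a ∧ ∀ {Ω : Type*} [MeasurableSpace Ω] (μ : Measure Ω) [IsProbabilityMeasure μ]
      (ξ : ℕ → Ω → Word) (S₀ : Word), IsEVChain 0 p μ ξ → (∀ᵐ ω ∂μ, ξ 0 ω = S₀) →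
      ∀ᵐ ω ∂μ, ∀ᶠ t : ℕ in atTop, a * t ≤ inversions (ξ t ω) := by
  have hp' : 0 < 1 - p := by linarith
  set s : ℝ := 1 / (2 * (1 - p)) with hs
  have hs0 : 0 < s := by positivity
  have hs1 : s < 1 := by rw [hs, div_lt_one (by positivity)]; linarith
  have hsp : s * (1 - p) = 1 / 2 := by rw [hs]; field_simp
  set δ : ℝ := (1 - s) * ((1 - p) - p / s) / 2 with hδ
  have hps : p / s < 1 - p := by rw [div_lt_iff₀ hs0]; linarith
  have hps0 : 0 ≤ p / s := by positivity
  have hδ0 : 0 < δ := by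
    have h1 : 0 < 1 - s := by linarith
    have h2 : 0 < 1 - p - p / s := by linarith
    positivity
  have hδ1 : δ ≤ 1 / 2 := by rw [hδ]; nlinarith
  refine ⟨Real.log (1 - δ / 2) / Real.log s, div_pos_of_neg_of_neg
    (Real.log_neg (by linarith) (by linarith)) (Real.log_neg hs0 hs1), ?_⟩
  intro Ω _ μ _ ξ S₀ hξ h0
  have := ae_eventually_lt_of_stepMean_le hp0 (by linarith) hξ h0
    (V := fun w => s ^ inversions w) (fun w => by positivity) (c := 1 - δ) (by linarith)
    (stepMean_pow_inversions_le hp0 hs0 hs1.le (by linarith))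
    (b := fun t => (1 - δ / 2) ^ t) (fun t => pow_pos (by linarith) _) (by
      simp_rw [← div_pow]
      refine summable_geometric_of_lt_one (div_nonneg (by linarith) (by linarith)) ?_
      rw [div_lt_one (by linarith)]
      linarith)
  filter_upwards [this] with ω hω
  filter_upwards [hω] with t ht
  have h1 := Real.log_lt_log (by positivity) ht
  rw [Real.log_pow, Real.log_pow] at h1
  rw [div_mul_eq_mul_div, div_le_iff_of_neg (Real.log_neg hs0 hs1)]
  linarith

theorem exists_sqrt_upper_bound_length (hp0 : 0 ≤ p) (hp : p < 1 / 2)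
    (hξ : IsEVChain 0 p μ ξ) (h0 : ∀ᵐ ω ∂μ, ξ 0 ω = S₀) :
    ∃ C : ℝ, 0 < C ∧ ∀ᵐ ω ∂μ, ∀ᶠ t : ℕ in atTop,
      ((ξ t ω).length : ℝ) ≤ C * √(t + 1) := by
  have hp' : 0 < 1 - p := by linarith
  set r : ℝ := √(1 / (2 * (1 - p))) with hr
  have hr0 : 0 < r := Real.sqrt_pos.2 (by positivity)
  have hr1 : r < 1 := by
    rw [hr, Real.sqrt_lt' one_pos, one_pow, div_lt_one (by positivity)]
    linarith
  have hrp : r ^ 2 * (1 - p) = 1 / 2 := by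
    rw [hr, Real.sq_sqrt (by positivity)]
    field_simp
  have hr1' : 0 < 1 - r := by linarith
  set B : ℝ := √(1 + (1 - r) ^ 2) with hB
  have hB2 : B ^ 2 = 1 + (1 - r) ^ 2 := Real.sq_sqrt (by positivity)
  have hB1 : 1 < B := by
    rw [hB, Real.lt_sqrt (by norm_num)]
    have : 0 < (1 - r) ^ 2 := by positivity
    linarith
  have hlB : 0 < Real.log B := Real.log_pos hB1
  have hlr : Real.log r < 0 := Real.log_neg hr0 hr1
  have hlr' : Real.log (1 - r) < 0 := Real.log_neg hr1' (by linarith)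
  refine ⟨(4 + 4 * -Real.log r + -Real.log (1 - r)) / Real.log B,
    div_pos (by linarith) hlB, ?_⟩
  have hW := ae_eventually_lt_of_stepMean_le hp0 (by linarith) hξ h0
    (V := fun w => B ^ w.length * cutWeight r w)
    (fun w => mul_nonneg (by positivity) (cutWeight_nonneg hr0.le hr1.le w))
    (c := 1) (by norm_num)
    (stepMean_lengthWeight_le hp0 (by linarith) hr0 hr1.le (by linarith) hB1.le hB2.le)
    (b := fun t => ((t : ℝ) + 1) ^ 2) (fun t => by positivity) (by
      simp_rw [one_pow]
      have := (summable_nat_add_iff 1).2 (Real.summable_one_div_nat_pow.2 one_lt_two)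
      simpa using this)
  filter_upwards [hW, ae_eventually_inversions_le hp0 (by linarith) hξ h0] with ω h1 h2
  filter_upwards [h1, h2] with t ht1 ht2
  obtain ⟨d, hd1, hd2⟩ := exists_sq_le_inversions_le_cutWeight hr0.le hr1.le (ξ t ω)
  have ht0 : (0 : ℝ) ≤ t := Nat.cast_nonneg t
  have hS0 : 0 ≤ √((t : ℝ) + 1) := Real.sqrt_nonneg _
  have hSsq : √((t : ℝ) + 1) ^ 2 = t + 1 := Real.sq_sqrt (by linarith)
  have hS1 : 1 ≤ √((t : ℝ) + 1) := Real.one_le_sqrt.2 (by linarith)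
  have hd : (d : ℝ) ≤ 2 * √((t : ℝ) + 1) := by
    refine abs_le_of_sq_le_sq' ?_ (by linarith) |>.2
    have : (d : ℝ) ^ 2 ≤ 2 * t := by exact_mod_cast hd1.trans ht2
    rw [mul_pow, hSsq]
    linarith
  have hlog : Real.log ((t : ℝ) + 1) ≤ 2 * √((t : ℝ) + 1) := by
    rw [← hSsq, Real.log_pow, hSsq]
    have := Real.log_le_sub_one_of_pos (show 0 < √((t : ℝ) + 1) by linarith)
    push_cast
    linarith
  have h3 : B ^ (ξ t ω).length * ((1 - r) * r ^ (2 * d)) < ((t : ℝ) + 1) ^ 2 :=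
    (mul_le_mul_of_nonneg_left hd2 (by positivity)).trans_lt ht1
  have h4 := Real.log_lt_log (by positivity) h3
  rw [Real.log_mul (by positivity) (by positivity), Real.log_mul hr1'.ne' (by positivity),
    Real.log_pow, Real.log_pow, Real.log_pow] at h4
  push_cast at h4
  rw [div_mul_eq_mul_div, le_div_iff₀ hlB]
  have h5 := mul_le_mul_of_nonneg_right hd (neg_nonneg.2 hlr.le)
  have h6 := mul_le_mul_of_nonneg_right hS1 (neg_nonneg.2 hlr'.le)
  linarith

end Bounds

theorem exists_forall_le_add_of_eventually_le {f g : ℕ → ℝ} (hf : ∀ n, 0 ≤ f n)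
    (hg : ∀ n, 0 ≤ g n) (h : ∀ᶠ n in atTop, f n ≤ g n) :
    ∃ M : ℝ, 0 ≤ M ∧ ∀ n, f n ≤ M + g n := by
  obtain ⟨T, hT⟩ := eventually_atTop.1 h
  have hM : 0 ≤ ∑ i ∈ Finset.range T, f i := Finset.sum_nonneg fun i _ => hf i
  refine ⟨_, hM, fun n => ?_⟩
  rcases lt_or_ge n T with hn | hn
  · have := Finset.single_le_sum (fun i _ => hf i) (Finset.mem_range.2 hn)
    linarith [hg n]
  · linarith [hT n hn]

theorem eventually_add_sqrt_le {C M ε : ℝ} (hC : 0 ≤ C) (hM : 0 ≤ M) (hε : 0 ≤ ε) :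
    ∀ᶠ t : ℕ in atTop,
      M + C * √((t : ℝ) + 1) ≤ (t : ℝ) ^ ((2 : ℝ) / 3) * Real.log t ^ ((1 : ℝ) / 3 + ε) := by
  have h1 : ∀ᶠ t : ℕ in atTop, M + 2 * C ≤ (t : ℝ) ^ ((1 : ℝ) / 6) :=
    ((tendsto_rpow_atTop (by norm_num)).comp tendsto_natCast_atTop_atTop).eventually_ge_atTop _
  have h2 : ∀ᶠ t : ℕ in atTop, 1 ≤ Real.log (t : ℝ) :=
    (Real.tendsto_log_atTop.comp tendsto_natCast_atTop_atTop).eventually_ge_atTop _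
  filter_upwards [h1, h2, eventually_ge_atTop 1] with t ht1 ht2 ht3
  have ht : (1 : ℝ) ≤ t := by exact_mod_cast ht3
  have hs : √((t : ℝ) + 1) ≤ 2 * (t : ℝ) ^ ((1 : ℝ) / 2) := by
    rw [← Real.sqrt_eq_rpow, Real.sqrt_le_left (by positivity), mul_pow,
      Real.sq_sqrt (by linarith)]
    linarith
  have hone : 1 ≤ (t : ℝ) ^ ((1 : ℝ) / 2) := Real.one_le_rpow ht (by norm_num)
  calc M + C * √((t : ℝ) + 1)
      ≤ M * (t : ℝ) ^ ((1 : ℝ) / 2) + C * (2 * (t : ℝ) ^ ((1 : ℝ) / 2)) :=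
        add_le_add (le_mul_of_one_le_right hM hone) (mul_le_mul_of_nonneg_left hs hC)
    _ = (M + 2 * C) * (t : ℝ) ^ ((1 : ℝ) / 2) := by ring
    _ ≤ (t : ℝ) ^ ((1 : ℝ) / 6) * (t : ℝ) ^ ((1 : ℝ) / 2) := by gcongr
    _ = (t : ℝ) ^ ((2 : ℝ) / 3) := by rw [← Real.rpow_add (by linarith)]; norm_num
    _ ≤ _ := le_mul_of_one_le_right (by positivity) (Real.one_le_rpow ht2 (by linarith))

/-- Theorem 8(ii): for `β = 0` and `p ∈ [0,1/2)`, a.s., for all but finitely many `t`,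
`max_{0≤s≤t} |ξ_s| ≤ t^{2/3}(log t)^{1/3+ε}`; moreover there is `c(p) ∈ (0,∞)` such
that for every `c ∈ (0,c(p))`, a.s., `|ξ_t| ≥ c t^{1/2}` for all but finitely many `t`. -/
theorem hybridZone_bounds_transient_pure_exclusion
    (p : ℝ) (hp0 : 0 ≤ p) (hp : p < 1 / 2)
    (S₀ : Word) (hS₀ : IsConfig S₀) :
    (∀ (Ω : Type) (_ : MeasurableSpace Ω) (μ : Measure Ω),
      IsProbabilityMeasure μ →
      ∀ ξ : ℕ → Ω → Word, IsEVChain 0 p μ ξ → (∀ᵐ ω ∂μ, ξ 0 ω = S₀) →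
        ∀ ε : ℝ, 0 < ε →
          ∀ᵐ ω ∂μ, ∀ᶠ t : ℕ in atTop, ∀ s ≤ t,
            (hz (ξ s ω) : ℝ) ≤ (t : ℝ) ^ ((2 : ℝ) / 3) * Real.log t ^ ((1 : ℝ) / 3 + ε)) ∧
    (∃ cp : ℝ, 0 < cp ∧
      ∀ c : ℝ, 0 < c → c < cp →
        ∀ (Ω : Type) (_ : MeasurableSpace Ω) (μ : Measure Ω),
          IsProbabilityMeasure μ →
          ∀ ξ : ℕ → Ω → Word, IsEVChain 0 p μ ξ → (∀ᵐ ω ∂μ, ξ 0 ω = S₀) →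
            ∀ᵐ ω ∂μ, ∀ᶠ t : ℕ in atTop,
              c * (t : ℝ) ^ ((1 : ℝ) / 2) ≤ (hz (ξ t ω) : ℝ)) := by

  refine ⟨?_, ?_⟩
  · intro Ω _ μ _ ξ hξ h0 ε hε
    obtain ⟨C, hC, hL⟩ := exists_sqrt_upper_bound_length hp0 hp hξ h0
    filter_upwards [hL] with ω hω
    obtain ⟨M, hM, hle⟩ := exists_forall_le_add_of_eventually_le
      (f := fun t => ((ξ t ω).length : ℝ)) (fun t => Nat.cast_nonneg _)
      (fun t => by positivity) hω
    filter_upwards [eventually_add_sqrt_le hC.le hM hε.le] with t ht s hs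
    refine (hle s).trans (le_trans ?_ ht)
    gcongr
  · obtain ⟨a, ha, hbound⟩ := exists_linear_lower_bound_inversions hp0 hp
    refine ⟨√a, Real.sqrt_pos.2 ha, fun c hc hca Ω _ μ _ ξ hξ h0 => ?_⟩
    filter_upwards [hbound μ ξ S₀ hξ h0] with ω hω
    filter_upwards [hω] with t ht
    have h1 : (inversions (ξ t ω) : ℝ) ≤ ((ξ t ω).length : ℝ) ^ 2 := by
      exact_mod_cast inversions_le (ξ t ω)
    rw [← Real.sqrt_eq_rpow]
    calc c * √(t : ℝ) ≤ √a * √(t : ℝ) := by gcongr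
      _ = √(a * t) := (Real.sqrt_mul ha.le _).symm
      _ ≤ √(((ξ t ω).length : ℝ) ^ 2) := Real.sqrt_le_sqrt (ht.trans h1)
      _ = (ξ t ω).length := Real.sqrt_sq (Nat.cast_nonneg _)

end EV
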